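/- Let M(λ) = M_0 + M_1λ + ⋯ + M_dλ^d ∈ F[λ]^{m×(m+n)} be a polynomial matrix such that rank(M_d) = m, let S_k be its Sylvester matrices with ranks r_k, and let d' be the smallest index k such that r_{k+1} = r_k + m. Then M(λ) is a minimal basis if and only if r_{d'} = m(d + d'). -/

import Mathlib

open Polynomial Matrix

noncomputable section

variable {F : Type*} [Field F]

/-- The rows of a polynomial matrix, viewed as vectors of rational functions. -/
def ratRow {p q : ℕ} (M : Matrix (Fin p) (Fin q) F[X]) (i : Fin p) :
    Fin q → RatFunc F :=
  fun j => algebraMap F[X] (RatFunc F) (M i j)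

/-- The rational vector subspace spanned by the rows of a polynomial matrix. -/
def rowSpan {p q : ℕ} (M : Matrix (Fin p) (Fin q) F[X]) :
    Submodule (RatFunc F) (Fin q → RatFunc F) :=
  Submodule.span (RatFunc F) (Set.range (ratRow M))

/-- The degree of the `i`-th row of a polynomial matrix. -/
def rowDeg {p q : ℕ} (M : Matrix (Fin p) (Fin q) F[X]) (i : Fin p) : ℕ :=
  Finset.univ.sup fun j => (M i j).natDegree

/-- The rows of `M` form a polynomial basis of the rational subspace `V` whose sum of
row degrees is minimal among all polynomial bases of `V`. -/
def IsMinimalBasisOf {p q : ℕ} (V : Submodule (RatFunc F) (Fin q → RatFunc F))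
    (M : Matrix (Fin p) (Fin q) F[X]) : Prop :=
  LinearIndependent (RatFunc F) (ratRow M) ∧ rowSpan M = V ∧
    ∀ M' : Matrix (Fin p) (Fin q) F[X],
      LinearIndependent (RatFunc F) (ratRow M') → rowSpan M' = V →
        ∑ i, rowDeg M i ≤ ∑ i, rowDeg M' i

/-- A polynomial matrix is a minimal basis if its rows form a minimal basis of the
rational subspace they span. -/
def IsMinimalBasis {p q : ℕ} (M : Matrix (Fin p) (Fin q) F[X]) : Prop :=
  IsMinimalBasisOf (rowSpan M) M

/-- A polynomial matrix viewed as a matrix of rational functions. -/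
def ratMat {p q : ℕ} (M : Matrix (Fin p) (Fin q) F[X]) :
    Matrix (Fin p) (Fin q) (RatFunc F) :=
  M.map (algebraMap F[X] (RatFunc F))

/-- The right null-space over `F(λ)` of a polynomial matrix. -/
def rightNullSpace {p q : ℕ} (M : Matrix (Fin p) (Fin q) F[X]) :
    Submodule (RatFunc F) (Fin q → RatFunc F) :=
  LinearMap.ker (Matrix.mulVecLin (ratMat M))

/-- The `k`-th Sylvester matrix of a polynomial matrix regarded as having degree at
most `e`: the block-Toeplitz matrix with `k` block columns whose `j`-th block column
carries the coefficients `M_0, …, M_e` in block rows `j, …, j+e` and zeros elsewhere. -/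
def sylv {p q : ℕ} (e k : ℕ) (M : Matrix (Fin p) (Fin q) F[X]) :
    Matrix (Fin (k + e) × Fin p) (Fin k × Fin q) F :=
  fun r c =>
    if (c.1 : ℕ) ≤ (r.1 : ℕ) ∧ (r.1 : ℕ) ≤ (c.1 : ℕ) + e then
      (M r.2 c.2).coeff ((r.1 : ℕ) - (c.1 : ℕ))
    else 0

/-- `M`, regarded as a polynomial matrix of degree at most `e`, has
full-Sylvester-rank if every Sylvester matrix `S_k`, `k ≥ 1`, has full rank. -/
def HasFullSylvesterRank {p q : ℕ} (e : ℕ) (M : Matrix (Fin p) (Fin q) F[X]) : Prop :=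
  ∀ k : ℕ, 1 ≤ k → (sylv e k M).rank = min ((k + e) * p) (k * q)

/-- The `k`-th coefficient matrix of a polynomial matrix. -/
def coeffMat {p q : ℕ} (k : ℕ) (M : Matrix (Fin p) (Fin q) F[X]) :
    Matrix (Fin p) (Fin q) F :=
  fun i j => (M i j).coeff k

/-- The highest-row-degree coefficient matrix: its `i`-th row is the coefficient of
`λ^{d_i}` in the `i`-th row of `M`, where `d_i` is the `i`-th row degree. -/
def highRowMat {p q : ℕ} (M : Matrix (Fin p) (Fin q) F[X]) :
    Matrix (Fin p) (Fin q) F :=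
  fun i j => (M i j).coeff (rowDeg M i)

/-- The `e`-reversal of a polynomial matrix: `rev_e P(λ) = λ^e P(1/λ)`. -/
def revMat {p q : ℕ} (e : ℕ) (P : Matrix (Fin p) (Fin q) F[X]) :
    Matrix (Fin p) (Fin q) F[X] :=
  fun i j => (P i j).reflect e


/-- The vectors of `p` polynomials of degree less than `k`, as an `F`-subspace. -/
def polyVecLT (F : Type*) [Field F] (p k : ℕ) : Submodule F (Fin p → F[X]) where
  carrier := {v | ∀ a l, k ≤ l → (v a).coeff l = 0}
  add_mem' := by
    intro v w hv hw a l hl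
    simp [hv a l hl, hw a l hl]
  zero_mem' := by
    intro a l _
    simp
  smul_mem' := by
    intro c v hv a l hl
    simp [hv a l hl]

lemma mem_polyVecLT {p k : ℕ} {v : Fin p → F[X]} :
    v ∈ polyVecLT F p k ↔ ∀ a l, k ≤ l → (v a).coeff l = 0 := Iff.rfl

/-- The vector of polynomials with prescribed coefficients. -/
def ofCoeffs (F : Type*) [Field F] (p k : ℕ) :
    (Fin k × Fin p → F) →ₗ[F] (Fin p → F[X]) where
  toFun x := fun a => ∑ j : Fin k, C (x (j, a)) * X ^ (j : ℕ)
  map_add' x y := by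
    ext1 a
    simp [add_mul, Finset.sum_add_distrib]
  map_smul' c x := by
    ext1 a
    simp [Finset.smul_sum, smul_eq_C_mul, mul_assoc]

lemma ofCoeffs_apply {p k : ℕ} (x : Fin k × Fin p → F) (a : Fin p) :
    ofCoeffs F p k x a = ∑ j : Fin k, C (x (j, a)) * X ^ (j : ℕ) := rfl

lemma coeff_ofCoeffs {p k : ℕ} (x : Fin k × Fin p → F) (a : Fin p) (l : ℕ) :
    (ofCoeffs F p k x a).coeff l = if h : l < k then x (⟨l, h⟩, a) else 0 := by
  simp only [ofCoeffs_apply, finsetSum_coeff, coeff_C_mul, coeff_X_pow, mul_ite, mul_one,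
    mul_zero]
  split_ifs with h
  · rw [Finset.sum_eq_single ⟨l, h⟩]
    · simp
    · intro b _ hb
      rw [if_neg]
      rintro rfl
      exact hb rfl
    · simp
  · refine Finset.sum_eq_zero fun b _ => if_neg ?_
    have := b.2
    omega

lemma ofCoeffs_injective (p k : ℕ) : Function.Injective (ofCoeffs F p k) := by
  intro x y h
  ext ⟨j, a⟩
  have := congrArg (fun v => (v a).coeff j) h
  simpa [coeff_ofCoeffs] using this

lemma range_ofCoeffs (p k : ℕ) : LinearMap.range (ofCoeffs F p k) = polyVecLT F p k := by
  ext v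
  constructor
  · rintro ⟨x, rfl⟩ a l hl
    rw [coeff_ofCoeffs, dif_neg (by omega)]
  · intro hv
    refine ⟨fun c => (v c.2).coeff c.1, ?_⟩
    ext a l
    rw [coeff_ofCoeffs]
    split_ifs with h
    · rfl
    · exact (hv a l (by omega)).symm

lemma finrank_polyVecLT (p k : ℕ) : Module.finrank F (polyVecLT F p k) = k * p := by
  rw [← range_ofCoeffs, LinearMap.finrank_range_of_inj (ofCoeffs_injective p k)]
  simp

instance (p k : ℕ) : FiniteDimensional F (polyVecLT F p k) := by
  rw [← range_ofCoeffs]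
  infer_instance

/-- The `F`-linear action of a polynomial matrix on vectors of polynomials. -/
def polyMulVec {p q : ℕ} (M : Matrix (Fin p) (Fin q) F[X]) :
    (Fin q → F[X]) →ₗ[F] (Fin p → F[X]) :=
  (Matrix.mulVecLin M).restrictScalars F

lemma polyMulVec_apply {p q : ℕ} (M : Matrix (Fin p) (Fin q) F[X]) (x : Fin q → F[X]) :
    polyMulVec M x = M *ᵥ x := rfl

/-- The image under `M` of the vectors of polynomials of degree less than `k`. -/
def imageLT {p q : ℕ} (M : Matrix (Fin p) (Fin q) F[X]) (k : ℕ) :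
    Submodule F (Fin p → F[X]) :=
  (polyVecLT F q k).map (polyMulVec M)

instance {p q : ℕ} (M : Matrix (Fin p) (Fin q) F[X]) (k : ℕ) :
    FiniteDimensional F (imageLT M k) := by
  unfold imageLT
  infer_instance

lemma mem_imageLT {p q k : ℕ} {M : Matrix (Fin p) (Fin q) F[X]} {y : Fin p → F[X]} :
    y ∈ imageLT M k ↔ ∃ x ∈ polyVecLT F q k, M *ᵥ x = y := Iff.rfl

lemma polyVecLT_mono (p : ℕ) {k l : ℕ} (h : k ≤ l) : polyVecLT F p k ≤ polyVecLT F p l :=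
  fun _ hv a i hi => hv a i (h.trans hi)

lemma imageLT_mono {p q : ℕ} (M : Matrix (Fin p) (Fin q) F[X]) {k l : ℕ} (h : k ≤ l) :
    imageLT M k ≤ imageLT M l :=
  Submodule.map_mono (polyVecLT_mono q h)

lemma ofCoeffs_sylv_mulVec {p q e : ℕ} (k : ℕ) {M : Matrix (Fin p) (Fin q) F[X]}
    (hdeg : ∀ i j, (M i j).natDegree ≤ e) (x : Fin k × Fin q → F) :
    ofCoeffs F p (k + e) (sylv e k M *ᵥ x) = M *ᵥ ofCoeffs F q k x := by
  ext a l
  rw [coeff_ofCoeffs]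
  have hR : ((M *ᵥ ofCoeffs F q k x) a).coeff l = ∑ b : Fin q, ∑ j : Fin k,
      (if (j : ℕ) ≤ l then (M a b).coeff (l - j) else 0) * x (j, b) := by
    simp only [Matrix.mulVec, dotProduct, finsetSum_coeff]
    refine Finset.sum_congr rfl fun b _ => ?_
    rw [ofCoeffs_apply, Finset.mul_sum, finsetSum_coeff]
    refine Finset.sum_congr rfl fun j _ => ?_
    rw [← mul_assoc, coeff_mul_X_pow', coeff_mul_C]
    split_ifs <;> simp
  rw [hR]
  split_ifs with h
  · simp only [Matrix.mulVec, dotProduct]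
    rw [Fintype.sum_prod_type, Finset.sum_comm]
    refine Finset.sum_congr rfl fun b _ => Finset.sum_congr rfl fun j _ => ?_
    congr 1
    by_cases h1 : (j : ℕ) ≤ l
    · by_cases h2 : l ≤ j + e
      · simp [sylv, h1, h2]
      · simp only [sylv, h1, h2, and_false, if_false, if_true]
        exact (coeff_eq_zero_of_natDegree_lt (by have := hdeg a b; omega)).symm
    · simp [sylv, h1]
  · symm
    refine Finset.sum_eq_zero fun b _ => Finset.sum_eq_zero fun j _ => ?_
    have := j.2
    rw [if_pos (by omega),
      coeff_eq_zero_of_natDegree_lt (by have := hdeg a b; omega), zero_mul]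

lemma map_range_sylv {p q e : ℕ} (k : ℕ) {M : Matrix (Fin p) (Fin q) F[X]}
    (hdeg : ∀ i j, (M i j).natDegree ≤ e) :
    (LinearMap.range (sylv e k M).mulVecLin).map (ofCoeffs F p (k + e)) = imageLT M k := by
  rw [imageLT, ← range_ofCoeffs, ← LinearMap.range_comp, ← LinearMap.range_comp]
  congr 1
  exact LinearMap.ext fun x => ofCoeffs_sylv_mulVec k hdeg x

lemma rank_sylv {p q e : ℕ} (k : ℕ) {M : Matrix (Fin p) (Fin q) F[X]}
    (hdeg : ∀ i j, (M i j).natDegree ≤ e) :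
    (sylv e k M).rank = Module.finrank F (imageLT M k) := by
  rw [← map_range_sylv k hdeg, Matrix.rank]
  exact (LinearEquiv.finrank_eq
    (Submodule.equivMapOfInjective _ (ofCoeffs_injective p (k + e)) _))

lemma imageLT_le {p q e : ℕ} (k : ℕ) {M : Matrix (Fin p) (Fin q) F[X]}
    (hdeg : ∀ i j, (M i j).natDegree ≤ e) : imageLT M k ≤ polyVecLT F p (k + e) := by
  rw [← map_range_sylv k hdeg, ← range_ofCoeffs]
  exact LinearMap.map_le_range

/-- The coefficientwise linear map of a vector of polynomials. -/
def coeffVec (F : Type*) [Field F] (p l : ℕ) : (Fin p → F[X]) →ₗ[F] (Fin p → F) where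
  toFun v := fun a => (v a).coeff l
  map_add' v w := by
    ext
    simp
  map_smul' c v := by
    ext
    simp

lemma coeffVec_apply {p l : ℕ} (v : Fin p → F[X]) (a : Fin p) :
    coeffVec F p l v a = (v a).coeff l := rfl

lemma exists_mulVec_coeffMat_eq {p q e : ℕ} {M : Matrix (Fin p) (Fin q) F[X]}
    (hMe : (coeffMat e M).rank = p) (z : Fin p → F) : ∃ w, coeffMat e M *ᵥ w = z := by
  have : LinearMap.range (coeffMat e M).mulVecLin = ⊤ := by
    apply Submodule.eq_top_of_finrank_eq
    rw [Module.finrank_fin_fun]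
    exact hMe
  exact LinearMap.range_eq_top.mp this z

lemma finrank_imageLT_succ {p q e : ℕ} (k : ℕ) {M : Matrix (Fin p) (Fin q) F[X]}
    (hdeg : ∀ i j, (M i j).natDegree ≤ e) (hMe : (coeffMat e M).rank = p) :
    Module.finrank F (imageLT M (k + 1)) =
      Module.finrank F ↥(imageLT M (k + 1) ⊓ polyVecLT F p (k + e)) + p := by
  set f := (coeffVec F p (k + e)).domRestrict (imageLT M (k + 1)) with hf
  have hr : LinearMap.range f = ⊤ := by
    rw [LinearMap.range_eq_top]
    intro z
    obtain ⟨w, rfl⟩ := exists_mulVec_coeffMat_eq hMe z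
    refine ⟨⟨M *ᵥ (fun b => C (w b) * X ^ k), mem_imageLT.mpr ⟨_, ?_, rfl⟩⟩, ?_⟩
    · intro b l hl
      rw [coeff_C_mul_X_pow, if_neg (by omega)]
    · ext a
      simp only [hf, LinearMap.domRestrict_apply, coeffVec_apply, Matrix.mulVec, dotProduct,
        finsetSum_coeff]
      refine Finset.sum_congr rfl fun b _ => ?_
      rw [← mul_assoc, add_comm k e, coeff_mul_X_pow, coeff_mul_C]
      rfl
  have hk : (LinearMap.ker f).map (imageLT M (k + 1)).subtype =
      imageLT M (k + 1) ⊓ polyVecLT F p (k + e) := by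
    ext y
    constructor
    · rintro ⟨⟨y, hy⟩, hy0, rfl⟩
      refine ⟨hy, fun a l hl => ?_⟩
      rcases hl.eq_or_lt with rfl | hl
      · exact congrFun hy0 a
      · exact imageLT_le (k + 1) hdeg hy a l (by omega)
    · rintro ⟨hy, hy'⟩
      exact ⟨⟨y, hy⟩, funext fun a => hy' a _ le_rfl, rfl⟩
  have h1 := LinearMap.finrank_range_add_finrank_ker f
  rw [hr, finrank_top, Module.finrank_fin_fun] at h1
  have h2 : Module.finrank F ((LinearMap.ker f).map (imageLT M (k + 1)).subtype) =
      Module.finrank F (LinearMap.ker f) :=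
    (LinearEquiv.finrank_eq (Submodule.equivMapOfInjective _
      (Submodule.subtype_injective _) _)).symm
  rw [← hk, h2]
  omega

lemma imageLT_inf_le_of_rank {p q e k : ℕ} {M : Matrix (Fin p) (Fin q) F[X]}
    (hdeg : ∀ i j, (M i j).natDegree ≤ e) (hMe : (coeffMat e M).rank = p)
    (hk : (sylv e (k + 1) M).rank = (sylv e k M).rank + p) :
    imageLT M (k + 1) ⊓ polyVecLT F p (k + e) ≤ imageLT M k := by
  rw [rank_sylv _ hdeg, rank_sylv _ hdeg, finrank_imageLT_succ k hdeg hMe] at hk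
  have hle : imageLT M k ≤ imageLT M (k + 1) ⊓ polyVecLT F p (k + e) :=
    le_inf (imageLT_mono M (Nat.le_succ k)) (imageLT_le k hdeg)
  exact (Submodule.eq_of_le_of_finrank_eq hle (by omega)).ge

lemma imageLT_inf_le_succ {p q e k : ℕ} {M : Matrix (Fin p) (Fin q) F[X]}
    (hdeg : ∀ i j, (M i j).natDegree ≤ e)
    (hk : imageLT M (k + 1) ⊓ polyVecLT F p (k + e) ≤ imageLT M k) :
    imageLT M (k + 1 + 1) ⊓ polyVecLT F p (k + 1 + e) ≤ imageLT M (k + 1) := by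
  rintro y ⟨⟨x, hx, rfl⟩, hy⟩
  set x₀ : Fin q → F[X] := fun b => C ((x b).coeff 0) with hx₀
  set x₁ : Fin q → F[X] := fun b => (x b).divX with hx₁
  have hx01 : x = x₀ + (X : F[X]) • x₁ := by
    ext1 b
    simp only [hx₀, hx₁, Pi.add_apply, Pi.smul_apply, smul_eq_mul]
    rw [add_comm, X_mul, divX_mul_X_add]
  have hMx : M *ᵥ x = M *ᵥ x₀ + (X : F[X]) • (M *ᵥ x₁) := by
    rw [← Matrix.mulVec_smul, ← Matrix.mulVec_add, ← hx01]
  have h0 : x₀ ∈ polyVecLT F q 1 := fun b l hl => by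
    rw [hx₀, coeff_C, if_neg (by omega)]
  have h1 : M *ᵥ x₁ ∈ imageLT M k := by
    refine hk ⟨⟨x₁, fun b l hl => ?_, rfl⟩, fun a l hl => ?_⟩
    · rw [hx₁, coeff_divX]
      exact hx b _ (by omega)
    · have h2 := hy a (l + 1) (by omega)
      rw [polyMulVec_apply, hMx] at h2
      have h3 := imageLT_le 1 hdeg (mem_imageLT.mpr ⟨x₀, h0, rfl⟩) a (l + 1) (by omega)
      simpa [h3, coeff_X_mul] using h2
  obtain ⟨x₂, hx₂, h2⟩ := mem_imageLT.mp h1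
  refine mem_imageLT.mpr ⟨x₀ + (X : F[X]) • x₂, ?_, ?_⟩
  · refine Submodule.add_mem _ (polyVecLT_mono q (by omega) h0) fun b l hl => ?_
    obtain ⟨l, rfl⟩ : ∃ i, l = i + 1 := ⟨l - 1, by omega⟩
    simpa [coeff_X_mul] using hx₂ b l (by omega)
  · rw [polyMulVec_apply, hMx, Matrix.mulVec_add, Matrix.mulVec_smul, h2]

lemma imageLT_inf_le {p q e k : ℕ} {M : Matrix (Fin p) (Fin q) F[X]}
    (hdeg : ∀ i j, (M i j).natDegree ≤ e)
    (hk : imageLT M (k + 1) ⊓ polyVecLT F p (k + e) ≤ imageLT M k) (i : ℕ) :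
    imageLT M (k + i) ⊓ polyVecLT F p (k + e) ≤ imageLT M k := by
  have hstep : ∀ i, imageLT M (k + i + 1) ⊓ polyVecLT F p (k + i + e) ≤ imageLT M (k + i) := by
    intro i
    induction i with
    | zero => exact hk
    | succ i ih => exact imageLT_inf_le_succ hdeg ih
  induction i with
  | zero => exact inf_le_left
  | succ i ih =>
    rintro y ⟨hy, hy'⟩
    exact ih ⟨hstep i ⟨hy, polyVecLT_mono p (by omega) hy'⟩, hy'⟩

lemma exists_mem_polyVecLT {p : ℕ} (x : Fin p → F[X]) : ∃ k, x ∈ polyVecLT F p k := by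
  refine ⟨(Finset.univ.sup fun b => (x b).natDegree) + 1, fun b l hl => ?_⟩
  apply coeff_eq_zero_of_natDegree_lt
  have := Finset.le_sup (f := fun b => (x b).natDegree) (Finset.mem_univ b)
  omega

lemma surjective_iff_sylv_rank {p q e k : ℕ} (he : 0 < e) {M : Matrix (Fin p) (Fin q) F[X]}
    (hdeg : ∀ i j, (M i j).natDegree ≤ e) (hMe : (coeffMat e M).rank = p)
    (hk : (sylv e (k + 1) M).rank = (sylv e k M).rank + p) :
    Function.Surjective M.mulVecLin ↔ (sylv e k M).rank = p * (e + k) := by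
  have hfull : (sylv e k M).rank = p * (e + k) ↔ imageLT M k = polyVecLT F p (k + e) := by
    rw [rank_sylv k hdeg, mul_comm, add_comm e k, ← finrank_polyVecLT (F := F)]
    exact ⟨Submodule.eq_of_le_of_finrank_eq (imageLT_le k hdeg), fun h => by rw [h]⟩
  rw [hfull]
  constructor
  · intro hs
    refine le_antisymm (imageLT_le k hdeg) fun y hy => ?_
    obtain ⟨x, rfl⟩ := hs y
    obtain ⟨i, hx⟩ := exists_mem_polyVecLT x
    exact imageLT_inf_le hdeg (imageLT_inf_le_of_rank hdeg hMe hk) i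
      ⟨mem_imageLT.mpr ⟨x, polyVecLT_mono q (by omega) hx, rfl⟩, hy⟩
  · intro h
    rw [← LinearMap.range_eq_top, eq_top_iff, ← (Pi.basisFun F[X] (Fin p)).span_eq,
      Submodule.span_le]
    rintro _ ⟨i, rfl⟩
    have hi : Pi.basisFun F[X] (Fin p) i ∈ imageLT M k := by
      rw [h]
      intro a l hl
      rw [Pi.basisFun_apply, Pi.single_apply]
      split_ifs
      · rw [coeff_one, if_neg (by omega)]
      · simp
    obtain ⟨x, -, hx⟩ := mem_imageLT.mp hi
    exact ⟨x, hx⟩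

lemma vecMul_coeffMat_ne_zero {p q e : ℕ} {M : Matrix (Fin p) (Fin q) F[X]}
    (hMe : (coeffMat e M).rank = p) {z : Fin p → F} (hz : z ≠ 0) :
    z ᵥ* coeffMat e M ≠ 0 := by
  intro h
  apply hz
  rw [← dotProduct_eq_zero_iff]
  intro y
  obtain ⟨w, rfl⟩ := exists_mulVec_coeffMat_eq hMe y
  rw [Matrix.dotProduct_mulVec, h, zero_dotProduct]

/-- Predictable degree: a nonzero polynomial combination of the rows of `M` has degree at
least `e` when the coefficient matrix of degree `e` has full row rank. -/
lemma exists_le_natDegree_vecMul {p q e : ℕ} {M : Matrix (Fin p) (Fin q) F[X]}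
    (hdeg : ∀ i j, (M i j).natDegree ≤ e) (hMe : (coeffMat e M).rank = p)
    {t : Fin p → F[X]} (ht : t ≠ 0) : ∃ j, e ≤ ((t ᵥ* M) j).natDegree := by
  obtain ⟨i₀, hi₀⟩ := Function.ne_iff.mp ht
  obtain ⟨i, -, hi⟩ := Finset.exists_max_image Finset.univ (fun i => (t i).degree)
    ⟨i₀, Finset.mem_univ i₀⟩
  have hti : t i ≠ 0 := by
    intro h
    have := hi i₀ (Finset.mem_univ _)
    simp only [h, degree_zero, le_bot_iff, degree_eq_bot] at this
    exact hi₀ this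
  set s := (t i).natDegree with hs
  have hle : ∀ k, (t k).natDegree ≤ s := fun k =>
    natDegree_le_natDegree (hi k (Finset.mem_univ _))
  have hz : (fun k => (t k).coeff s) ≠ 0 :=
    Function.ne_iff.mpr ⟨i, by simpa [hs] using hti⟩
  obtain ⟨j, hj⟩ := Function.ne_iff.mp (vecMul_coeffMat_ne_zero hMe hz)
  refine ⟨j, (Nat.le_add_left e s).trans (le_natDegree_of_ne_zero ?_)⟩
  rw [Pi.zero_apply] at hj
  convert hj using 1
  simp only [Matrix.vecMul, dotProduct, finsetSum_coeff]
  exact Finset.sum_congr rfl fun k _ => coeff_mul_add_eq_of_natDegree_le (hle k) (hdeg k j)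

lemma rowDeg_le_iff {p q : ℕ} {M : Matrix (Fin p) (Fin q) F[X]} {i : Fin p} {e : ℕ} :
    rowDeg M i ≤ e ↔ ∀ j, (M i j).natDegree ≤ e := by
  simp [rowDeg]

lemma natDegree_le_rowDeg {p q : ℕ} (M : Matrix (Fin p) (Fin q) F[X]) (i : Fin p) (j : Fin q) :
    (M i j).natDegree ≤ rowDeg M i :=
  rowDeg_le_iff.mp le_rfl j

lemma isMinimalBasis_of_surjective {p q e : ℕ} {M : Matrix (Fin p) (Fin q) F[X]}
    (hdeg : ∀ i j, (M i j).natDegree ≤ e) (hMe : (coeffMat e M).rank = p)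
    (hs : Function.Surjective M.mulVecLin) : IsMinimalBasis M := by
  choose N hN using fun k : Fin p => hs (Pi.single k 1)
  have hMN : ∀ i k, ∑ j, M i j * N k j = if i = k then 1 else 0 := by
    intro i k
    have := congrFun (hN k) i
    rwa [Pi.single_apply] at this
  have hcoord : ∀ (c : Fin p → RatFunc F) (k : Fin p),
      ∑ j, (∑ i, c i • ratRow M i) j * algebraMap F[X] (RatFunc F) (N k j) = c k := by
    intro c k
    have h : ∀ i, ∑ j, ratRow M i j * algebraMap F[X] (RatFunc F) (N k j) =
        if i = k then 1 else 0 := by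
      intro i
      simp only [ratRow, ← map_mul, ← map_sum, hMN]
      split_ifs <;> simp
    simp only [Finset.sum_apply, Pi.smul_apply, smul_eq_mul, Finset.sum_mul]
    rw [Finset.sum_comm]
    simp only [mul_assoc, ← Finset.mul_sum, h]
    simp
  refine ⟨?_, rfl, fun M' hM' hspan => ?_⟩
  · rw [Fintype.linearIndependent_iff]
    intro c hc k
    rw [← hcoord c k, hc]
    simp
  · refine Finset.sum_le_sum fun i _ => (rowDeg_le_iff.mpr (hdeg i)).trans ?_
    have hi : ratRow M' i ∈ rowSpan M := hspan ▸ Submodule.subset_span ⟨i, rfl⟩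
    obtain ⟨c, hc⟩ := (Submodule.mem_span_range_iff_exists_fun _).mp hi
    set t : Fin p → F[X] := fun k => ∑ j, M' i j * N k j with ht
    have hct : ∀ k, c k = algebraMap F[X] (RatFunc F) (t k) := by
      intro k
      rw [← hcoord c k, hc]
      simp [ht, ratRow]
    have htM : ∀ j, (t ᵥ* M) j = M' i j := by
      intro j
      apply RatFunc.algebraMap_injective F
      have := congrFun hc j
      simp only [Finset.sum_apply, Pi.smul_apply, smul_eq_mul, hct, ratRow] at this
      rw [← this]
      simp [Matrix.vecMul, dotProduct]
    have ht0 : t ≠ 0 := by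
      intro h
      apply hM'.ne_zero i
      ext1 j
      simp [ratRow, ← htM, h]
    obtain ⟨j, hj⟩ := exists_le_natDegree_vecMul hdeg hMe ht0
    rw [htM] at hj
    exact hj.trans (natDegree_le_rowDeg M' i j)

/-- If `M` is not surjective, then some nonzero combination of its rows with coefficients
reduced modulo a nonzero polynomial `g` is divisible by `g`. -/
lemma exists_dvd_vecMul_of_not_surjective {p q : ℕ} {M : Matrix (Fin p) (Fin q) F[X]}
    (hs : ¬ Function.Surjective M.mulVecLin) :
    ∃ (g : F[X]) (u : Fin p → F[X]), g ≠ 0 ∧ u ≠ 0 ∧ (∀ i, (u i).degree < g.degree) ∧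
      ∀ j, g ∣ (u ᵥ* M) j := by
  rw [← LinearMap.range_eq_top] at hs
  obtain ⟨L, hL, hML⟩ := (eq_top_or_exists_le_coatom (LinearMap.range M.mulVecLin)).resolve_left hs
  have hsimple : IsSimpleModule F[X] ((Fin p → F[X]) ⧸ L) := isSimpleModule_iff_isCoatom.mpr hL
  obtain ⟨I, hI, ⟨ψ⟩⟩ := isSimpleModule_iff_quot_maximal.mp hsimple
  have hI0 : I ≠ ⊥ := Ring.ne_bot_of_isMaximal_of_not_isField hI (Polynomial.not_isField F)
  obtain ⟨g, rfl⟩ : ∃ g, I = Ideal.span {g} := (IsPrincipalIdealRing.principal I).principal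
  have hg : g ≠ 0 := by
    rintro rfl
    simp at hI0
  set φ : (Fin p → F[X]) →ₗ[F[X]] F[X] ⧸ Ideal.span {g} := ψ.toLinearMap ∘ₗ L.mkQ with hφ
  choose u' hu' using fun i => Ideal.Quotient.mk_surjective (φ (Pi.single i 1))
  have hu : ∀ i, Ideal.Quotient.mk (Ideal.span {g}) (u' i % g) = φ (Pi.single i 1) := by
    intro i
    rw [← hu', Ideal.Quotient.eq, Ideal.mem_span_singleton]
    exact ⟨-(u' i / g), by linear_combination EuclideanDomain.div_add_mod (u' i) g⟩
  have hφv : ∀ v : Fin p → F[X],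
      φ v = Ideal.Quotient.mk (Ideal.span {g}) (∑ i, (u' i % g) * v i) := by
    intro v
    conv_lhs => rw [pi_eq_sum_univ' v]
    simp only [map_sum, map_smul, map_mul]
    refine Finset.sum_congr rfl fun i _ => ?_
    rw [hu, mul_comm]
    exact Algebra.smul_def (v i) (φ (Pi.single i 1))
  refine ⟨g, fun i => u' i % g, hg, ?_, fun i => degree_mod_lt _ hg, fun j => ?_⟩
  · intro h
    have hφ0 : ∀ v, φ v = 0 := by
      intro v
      rw [hφv]
      simp [congrFun h]
    apply hL.1
    rw [eq_top_iff]
    intro v _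
    have := hφ0 v
    rw [hφ, LinearMap.comp_apply] at this
    simpa using this
  · rw [← Ideal.mem_span_singleton, ← Ideal.Quotient.eq_zero_iff_mem]
    have h0 : φ (M *ᵥ Pi.single j 1) = 0 := by
      have : M *ᵥ Pi.single j 1 ∈ L := hML ⟨Pi.single j 1, rfl⟩
      rw [hφ, LinearMap.comp_apply, Submodule.mkQ_apply, (Submodule.Quotient.mk_eq_zero L).mpr this,
        map_zero]
    rw [hφv] at h0
    simpa [Matrix.vecMul, dotProduct] using h0

lemma surjective_of_isMinimalBasis {p q e : ℕ} (he : 0 < e) {M : Matrix (Fin p) (Fin q) F[X]}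
    (hdeg : ∀ i j, (M i j).natDegree ≤ e) (hMe : (coeffMat e M).rank = p)
    (hM : IsMinimalBasis M) : Function.Surjective M.mulVecLin := by
  by_contra hs
  obtain ⟨g, u, hg, hu, hug, hdvd⟩ := exists_dvd_vecMul_of_not_surjective hs
  choose v hv using hdvd
  obtain ⟨i, hi⟩ := Function.ne_iff.mp hu
  obtain ⟨hlin, -, hminimal⟩ := hM
  have hvdeg : ∀ j, (v j).natDegree < e := by
    intro j
    rcases eq_or_ne (v j) 0 with h0 | h0
    · simpa [h0] using he
    have h1 : (g * v j).degree < g.degree + e := by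
      rw [← hv, Matrix.vecMul, dotProduct]
      have hbot : ⊥ < g.degree + e := by
        rw [degree_eq_natDegree hg]
        exact WithBot.bot_lt_coe (g.natDegree + e)
      refine (degree_sum_le _ _).trans_lt ((Finset.sup_lt_iff hbot).mpr fun k _ => ?_)
      rw [degree_mul]
      calc (u k).degree + (M k j).degree ≤ (u k).degree + e :=
            add_le_add_right (degree_le_of_natDegree_le (hdeg k j)) _
        _ < g.degree + e := WithBot.add_lt_add_right (WithBot.coe_ne_bot (a := e)) (hug k)
    rw [degree_mul, WithBot.add_lt_add_iff_left (by simpa using hg)] at h1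
    exact (natDegree_lt_iff_degree_lt h0).mpr h1
  set M' := M.updateRow i v with hM'
  have hrow : ∀ k, k ≠ i → ratRow M' k = ratRow M k := by
    intro k hk
    ext1 j
    simp [ratRow, hM', hk]
  have hrowi : ratRow M' i = fun j => algebraMap F[X] (RatFunc F) (v j) := by
    ext1 j
    simp [ratRow, hM']
  set α := algebraMap F[X] (RatFunc F) with hα
  have hα0 : ∀ {f : F[X]}, f ≠ 0 → α f ≠ 0 := fun hf => by
    simpa [hα] using hf
  have hcomb : α g • ratRow M' i = ∑ k, α (u k) • ratRow M k := by
    ext1 j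
    rw [hrowi]
    simp only [Pi.smul_apply, smul_eq_mul, Finset.sum_apply, ratRow, ← hα, ← map_mul, ← map_sum,
      ← hv]
    rfl
  have hspan : rowSpan M' = rowSpan M := by
    have hmem : ∀ k, ratRow M k ∈ rowSpan M := fun k => Submodule.subset_span ⟨k, rfl⟩
    have hmem' : ∀ k, ratRow M' k ∈ rowSpan M' := fun k => Submodule.subset_span ⟨k, rfl⟩
    apply le_antisymm
    · refine Submodule.span_le.mpr ?_
      rintro _ ⟨k, rfl⟩
      rcases eq_or_ne k i with rfl | hk
      · rw [SetLike.mem_coe, ← Submodule.smul_mem_iff _ (hα0 hg), hcomb]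
        exact Submodule.sum_mem _ fun l _ => Submodule.smul_mem _ _ (hmem l)
      · rw [hrow k hk]
        exact hmem k
    · refine Submodule.span_le.mpr ?_
      rintro _ ⟨k, rfl⟩
      rcases eq_or_ne k i with rfl | hk
      · rw [SetLike.mem_coe, ← Submodule.smul_mem_iff _ (hα0 hi)]
        rw [← Finset.add_sum_erase _ _ (Finset.mem_univ k), ← sub_eq_iff_eq_add] at hcomb
        rw [← hcomb]
        refine Submodule.sub_mem _ (Submodule.smul_mem _ _ (hmem' k))
          (Submodule.sum_mem _ fun l hl => Submodule.smul_mem _ _ ?_)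
        rw [← hrow l (Finset.ne_of_mem_erase hl)]
        exact hmem' l
      · rw [← hrow k hk]
        exact hmem' k
  have hlin' : LinearIndependent (RatFunc F) (ratRow M') := by
    rw [linearIndependent_iff_card_eq_finrank_span] at hlin ⊢
    rw [hlin]
    exact congrArg (fun V : Submodule _ _ => Module.finrank (RatFunc F) V) hspan.symm
  refine absurd (hminimal M' hlin' hspan) (not_le.mpr ?_)
  have hrowM' : rowDeg M' i < rowDeg M i := by
    obtain ⟨j, hj⟩ := exists_le_natDegree_vecMul hdeg hMe
      (t := Pi.single i 1) (by simp)
    rw [Matrix.single_one_vecMul] at hj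
    refine lt_of_lt_of_le ?_ (hj.trans (natDegree_le_rowDeg M i j))
    refine Nat.lt_of_le_pred he (rowDeg_le_iff.mpr fun j => ?_)
    have := hvdeg j
    simp only [hM', Matrix.updateRow_self]
    exact Nat.le_pred_of_lt this
  refine Finset.sum_lt_sum (fun k _ => ?_) ⟨i, Finset.mem_univ i, hrowM'⟩
  rcases eq_or_ne k i with rfl | hk
  · exact hrowM'.le
  · simp [rowDeg, hM', hk]

/-- If the leading coefficient `M_d` has full row rank `m` and `d'` is the smallest
index `k` with `r_{k+1} = r_k + m`, then `M(λ)` is a minimal basis if and only if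
`r_{d'} = m(d + d')`. -/
theorem isMinimalBasis_iff_sylvester_rank_of_leading_full {F : Type*} [Field F]
    {m n d : ℕ} (hm : 0 < m) (hn : 0 < n) (hd : 0 < d)
    (M : Matrix (Fin m) (Fin (m + n)) F[X]) (hdeg : ∀ i j, (M i j).natDegree ≤ d)
    (hMd : (coeffMat d M).rank = m)
    (d' : ℕ) (hd' : (sylv d (d' + 1) M).rank = (sylv d d' M).rank + m)
    (hmin : ∀ j < d', (sylv d (j + 1) M).rank ≠ (sylv d j M).rank + m) :
    IsMinimalBasis M ↔ (sylv d d' M).rank = m * (d + d') := by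
  rw [← surjective_iff_sylv_rank hd hdeg hMd hd']
  exact ⟨surjective_of_isMinimalBasis hd hdeg hMd, isMinimalBasis_of_surjective hdeg hMd⟩

end
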